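/- arXiv:2111.12822 — 2 statements merged into one kernel-verified Lean document; each statement's English description precedes it below -/
import Mathlib

section
/- (Strict positivity of the high-SNR optimal allocation.) In the power allocation setting, there exists γ_0 > 0 such that for every γ̄ ≥ γ_0 and every k = 1,…,K, the optimal allocation satisfies p*_k(γ̄) > 0. -/
open MeasureTheory Real Filter Set

/-- A function whose derivative has the form `a * x ^ (-d - 1) + O(x ^ (-d - 2))` with `d > 0` has
derivative tending to zero at infinity. -/
lemma tendsto_zero_of_abs_sub_rpow_le {f' : ℝ → ℝ} {a d C x0 : ℝ} (hd : 0 < d)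
    (h : ∀ x ≥ x0, |f' x - a * x ^ (-d - 1)| ≤ C * x ^ (-d - 2)) :
    Tendsto f' atTop (nhds 0) := by
  have h1 : Tendsto (fun x : ℝ => a * x ^ (-d - 1)) atTop (nhds 0) := by
    simpa [sub_eq_add_neg, add_comm] using
      (tendsto_rpow_neg_atTop (show 0 < d + 1 by linarith)).const_mul a
  have h2 : Tendsto (fun x : ℝ => C * x ^ (-d - 2)) atTop (nhds 0) := by
    simpa [sub_eq_add_neg, add_comm] using
      (tendsto_rpow_neg_atTop (show 0 < d + 2 by linarith)).const_mul C
  have h3 : Tendsto (fun x => f' x - a * x ^ (-d - 1)) atTop (nhds 0) :=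
    squeeze_zero_norm' (by filter_upwards [eventually_ge_atTop x0] with x hx using h x hx) h2
  simpa using h3.add h1

/-- If the derivative tends to zero at infinity, then so do the unit increments: eventually they
lie below any positive bound. -/
lemma eventually_sub_lt_of_deriv_tendsto_zero {f f' : ℝ → ℝ}
    (hf : ∀ x > 0, HasDerivAt f (f' x) x) (hf' : Tendsto f' atTop (nhds 0))
    {c : ℝ} (hc : 0 < c) : ∀ᶠ x in atTop, f x - f (x - 1) < c := by
  obtain ⟨M, hM⟩ := eventually_atTop.1 (hf'.eventually (gt_mem_nhds hc))
  filter_upwards [eventually_ge_atTop (M + 1), eventually_gt_atTop 1] with x hxM hx1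
  obtain ⟨y, hy, hslope⟩ := exists_hasDerivAt_eq_slope f f' (sub_one_lt x)
    (fun z hz => (hf z (by linarith [hz.1])).continuousAt.continuousWithinAt)
    (fun z hz => hf z (by linarith [hz.1]))
  have hy' := hM y (by linarith [hy.1])
  rw [hslope] at hy'
  simpa using hy'

/-- **Strict positivity of the high-SNR optimal allocation.**
In the power allocation setting, there exists `γ₀ > 0` such that for every `γ̄ ≥ γ₀` and every
`k`, the optimal allocation satisfies `p*_k(γ̄) > 0`. -/
theorem power_allocation_strictly_positive
    (K : ℕ) (hK : 0 < K)
    (Ibar Ibar' : Fin K → ℝ → ℝ)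
    (hcont : ∀ k, ContinuousOn (Ibar k) (Set.Ici 0))
    (hmono : ∀ k, StrictMonoOn (Ibar k) (Set.Ici 0))
    (hderiv : ∀ k, ∀ x > (0 : ℝ), HasDerivAt (Ibar k) (Ibar' k x) x)
    (hderiv_cont : ∀ k, ContinuousOn (Ibar' k) (Set.Ioi 0))
    (hconc : ∀ k, StrictConcaveOn ℝ (Set.Ioi 0) (Ibar k))
    (hlim0 : ∀ k, Tendsto (Ibar' k) (nhdsWithin 0 (Set.Ioi 0)) (nhds 1))
    (A D : Fin K → ℝ) (hA : ∀ k, 0 < A k) (hD : ∀ k, 0 < D k)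
    (hasymp : ∀ k, ∃ C > 0, ∃ x0 > 0, ∀ x ≥ x0,
      |Ibar' k x - A k * D k * x ^ (-(D k) - 1)| ≤ C * x ^ (-(D k) - 2))
    (pstar : ℝ → Fin K → ℝ)
    (hpstar : ∀ γ > (0 : ℝ),
      ((∀ k, 0 ≤ pstar γ k) ∧ ∑ k, pstar γ k = 1) ∧
      ∀ q : Fin K → ℝ, (∀ k, 0 ≤ q k) → (∑ k, q k = 1) → q ≠ pstar γ →
        ∑ k, Ibar k (γ * q k) < ∑ k, Ibar k (γ * pstar γ k))
    (Dmin : ℝ) (hDmin : IsLeast (Set.range D) Dmin)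
    :
    ∃ γ0 > (0 : ℝ), ∀ γ ≥ γ0, ∀ k, 0 < pstar γ k := by
  have hincr : ∀ᶠ x in atTop, ∀ j k,
      Ibar j x - Ibar j (x - 1) < Ibar k 1 - Ibar k 0 := by
    refine eventually_all.2 fun j => eventually_all.2 fun k => ?_
    obtain ⟨C, -, x0, -, h⟩ := hasymp j
    exact eventually_sub_lt_of_deriv_tendsto_zero (hderiv j)
      (tendsto_zero_of_abs_sub_rpow_le (hD j) h)
      (sub_pos.2 (hmono k (by simp) (by simp) one_pos))
  obtain ⟨M, hM⟩ := eventually_atTop.1 hincr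
  have hK' : (0 : ℝ) < K := by exact_mod_cast hK
  refine ⟨K * max M 1, by positivity, fun γ hγ k => ?_⟩
  have hγ0 : 0 < γ := lt_of_lt_of_le (by positivity) hγ
  obtain ⟨⟨hnn, hsum⟩, hopt⟩ := hpstar γ hγ0
  by_contra hk
  have hk0 : pstar γ k = 0 := le_antisymm (not_lt.1 hk) (hnn k)
  obtain ⟨j, -, hj⟩ : ∃ j ∈ Finset.univ, (1 : ℝ) / K ≤ pstar γ j := by
    refine Finset.exists_le_of_sum_le ⟨k, Finset.mem_univ k⟩ ?_
    simp [hsum, hK'.ne']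
  have hjk : j ≠ k := by
    rintro rfl
    have : (0 : ℝ) < 1 / K := by positivity
    linarith
  have hx : max M 1 ≤ γ * pstar γ j := calc
    max M 1 = K * max M 1 * (1 / K) := by field_simp
    _ ≤ γ * pstar γ j := by gcongr
  have hjγ : 1 / γ ≤ pstar γ j := by
    rw [div_le_iff₀' hγ0]
    exact (le_max_right _ _).trans hx
  set q : Fin K → ℝ := pstar γ + Pi.single k (1 / γ) - Pi.single j (1 / γ) with hq
  have hqj : q j = pstar γ j - 1 / γ := by simp [hq, hjk]
  have hqk : q k = 1 / γ := by simp [hq, hjk.symm, hk0]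
  have hqi : ∀ i, i ≠ j ∧ i ≠ k → q i = pstar γ i := fun i hi => by simp [hq, hi.1, hi.2]
  have hγinv : 0 < 1 / γ := by positivity
  have hlt := hopt q
    (fun i => by
      by_cases hij : i = j
      · subst hij; linarith
      by_cases hik : i = k
      · subst hik; linarith
      · rw [hqi i ⟨hij, hik⟩]; exact hnn i)
    (by simp [hq, Finset.sum_add_distrib, hsum])
    (fun h => by have := congrFun h k; linarith)
  have hdiff : ∑ i, (Ibar i (γ * q i) - Ibar i (γ * pstar γ i)) =
      (Ibar j (γ * q j) - Ibar j (γ * pstar γ j)) +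
        (Ibar k (γ * q k) - Ibar k (γ * pstar γ k)) :=
    Fintype.sum_eq_add j k hjk fun i hi => by rw [hqi i hi, sub_self]
  have hγq : γ * (pstar γ j - 1 / γ) = γ * pstar γ j - 1 := by field_simp
  rw [Finset.sum_sub_distrib, hqj, hqk, hk0, hγq, mul_one_div_cancel hγ0.ne', mul_zero] at hdiff
  linarith [hM _ ((le_max_left _ _).trans hx) j k]
end

section
/- Let f be a mixture gamma density with parameters L, {α_l}, {β_l}, {ζ_l}, and let m be an MMSE-type function with induced quantity M̂. Then, as γ̄ → ∞, ∫_0^∞ a f(a) m(γ̄ a) da = (Σ_{l : β_l = β_1} α_l) · M̂(β_1) · γ̄^{−β_1−1} + O(γ̄^{−β_1−2}). -/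
open MeasureTheory Real Filter Set

/-- A function that is continuous on `(0, ∞)`, has limit `1` at `0` and decays like
`t ^ (-1/2) * exp (-c t)` is bounded on `(0, ∞)` by a decaying exponential. -/
lemma exists_le_mul_exp_neg {m : ℝ → ℝ} (hm_cont : ContinuousOn m (Ioi 0))
    (hm_lim : Tendsto m (nhdsWithin 0 (Ioi 0)) (nhds 1))
    (hm_decay : ∃ C > 0, ∃ c > 0, ∀ t ≥ 1, m t ≤ C * t ^ (-(1 : ℝ) / 2) * exp (-c * t)) :
    ∃ K : ℝ, ∃ c > 0, ∀ t > 0, m t ≤ K * exp (-c * t) := by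
  obtain ⟨C, hC, c, hc, hdecay⟩ := hm_decay
  have hev : ∀ᶠ t in nhdsWithin (0 : ℝ) (Ioi 0), m t < 2 :=
    hm_lim.eventually_lt_const (by norm_num)
  obtain ⟨δ, hδ, hδm⟩ := mem_nhdsGT_iff_exists_Ioo_subset.mp hev
  have hδ0 : (0 : ℝ) < δ := hδ
  obtain ⟨B, hB⟩ := (isCompact_Icc (a := δ) (b := 1)).bddAbove_image
    (hm_cont.mono fun t ht => lt_of_lt_of_le hδ0 ht.1)
  refine ⟨max (max 2 B) 0 * exp c + C, c, hc, fun t ht => ?_⟩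
  have hexp := exp_pos (-c * t)
  rcases le_total 1 t with h1 | h1
  · have hpow : t ^ (-(1 : ℝ) / 2) ≤ 1 := rpow_le_one_of_one_le_of_nonpos h1 (by norm_num)
    calc m t ≤ C * t ^ (-(1 : ℝ) / 2) * exp (-c * t) := hdecay t h1
      _ ≤ C * 1 * exp (-c * t) := by gcongr
      _ ≤ (max (max 2 B) 0 * exp c + C) * exp (-c * t) := by
        gcongr
        have : 0 ≤ max (max 2 B) 0 * exp c := by positivity
        linarith
  · have hmB : m t ≤ max (max 2 B) 0 := by
      rcases lt_or_ge t δ with h | h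
      · exact (hδm ⟨ht, h⟩ : m t < 2).le.trans ((le_max_left _ _).trans (le_max_left _ _))
      · exact (hB ⟨t, ⟨h, h1⟩, rfl⟩).trans ((le_max_right _ _).trans (le_max_left _ _))
    have hone : 1 ≤ exp c * exp (-c * t) := by
      rw [← exp_add]
      exact one_le_exp (by nlinarith)
    have hnn : 0 ≤ max (max 2 B) 0 := le_max_right _ _
    calc m t ≤ max (max 2 B) 0 * 1 := by simpa using hmB
      _ ≤ max (max 2 B) 0 * (exp c * exp (-c * t)) := by gcongr
      _ ≤ (max (max 2 B) 0 * exp c + C) * exp (-c * t) := by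
        have := mul_pos hC hexp
        linarith

/-- All moments of nonnegative order of an exponentially bounded function exist. -/
lemma integrableOn_rpow_mul_of_le_exp {m : ℝ → ℝ} (hm_cont : ContinuousOn m (Ioi 0))
    (hm_pos : ∀ t > 0, 0 < m t) {K c : ℝ} (hc : 0 < c)
    (hm_le : ∀ t > 0, m t ≤ K * exp (-c * t)) {x : ℝ} (hx : 0 < x) :
    IntegrableOn (fun t => t ^ x * m t) (Ioi 0) := by
  have hint : IntegrableOn (fun t : ℝ => K * (t ^ x * exp (-c * t))) (Ioi 0) :=
    (integrableOn_rpow_mul_exp_neg_mul_rpow (s := x) (p := 1) (by linarith) one_pos hc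
      |>.congr_fun (fun t _ => by simp) measurableSet_Ioi).const_mul K
  refine Integrable.mono' hint ?_ ?_
  · exact ((continuousOn_id.rpow_const fun t _ => Or.inr hx.le).mul hm_cont).aestronglyMeasurable
      measurableSet_Ioi
  · refine (ae_restrict_iff' measurableSet_Ioi).mpr (Eventually.of_forall fun t ht => ?_)
    have ht0 : 0 < t := ht
    have hpow : 0 < t ^ x := rpow_pos_of_pos ht0 x
    rw [norm_of_nonneg (mul_pos hpow (hm_pos t ht0)).le]
    calc t ^ x * m t ≤ t ^ x * (K * exp (-c * t)) := by gcongr; exact hm_le t ht0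
      _ = K * (t ^ x * exp (-c * t)) := by ring

section Rescaling

variable {m : ℝ → ℝ} {x z γ : ℝ}

/-- Exponential damping preserves the integrability of moments. -/
lemma integrableOn_rpow_mul_exp_mul (hint : IntegrableOn (fun t => t ^ x * m t) (Ioi 0))
    (hz : 0 ≤ z) : IntegrableOn (fun t => t ^ x * exp (-z * t) * m t) (Ioi 0) := by
  have hmeas : AEStronglyMeasurable (fun t => exp (-z * t)) (volume.restrict (Ioi 0)) :=
    (by fun_prop : Continuous fun t : ℝ => exp (-z * t)).aestronglyMeasurable
  refine (hint.bdd_mul (c := 1) hmeas ?_).congr (Eventually.of_forall fun t => ?_)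
  · refine (ae_restrict_iff' measurableSet_Ioi).mpr (Eventually.of_forall fun t ht => ?_)
    have ht0 : 0 < t := ht
    rw [norm_of_nonneg (exp_pos _).le]
    exact exp_le_one_iff.mpr (by nlinarith)
  · simp only
    ring

lemma rpow_mul_exp_mul_comp_mul (hγ : 0 < γ) {a : ℝ} (ha : 0 < a) :
    a ^ x * exp (-z * a) * m (γ * a) =
      γ ^ (-x) * ((γ * a) ^ x * exp (-(z / γ) * (γ * a)) * m (γ * a)) := by
  have h1 : γ ^ (-x) * γ ^ x = 1 := by rw [← rpow_add hγ]; simp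
  have h2 : -(z / γ) * (γ * a) = -z * a := by field_simp
  rw [mul_rpow hγ.le ha.le, h2]
  linear_combination (-(a ^ x * exp (-z * a) * m (γ * a))) * h1

lemma integrableOn_rpow_mul_exp_mul_comp_mul
    (hint : IntegrableOn (fun t => t ^ x * m t) (Ioi 0)) (hz : 0 ≤ z) (hγ : 0 < γ) :
    IntegrableOn (fun a => a ^ x * exp (-z * a) * m (γ * a)) (Ioi 0) := by
  have h := integrableOn_rpow_mul_exp_mul hint (div_nonneg hz hγ.le)
  have h' := (integrableOn_Ioi_comp_mul_left_iff
    (fun t => t ^ x * exp (-(z / γ) * t) * m t) 0 hγ).mpr (by simpa using h)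
  exact IntegrableOn.congr_fun (h'.const_mul (γ ^ (-x)))
    (fun a ha => (rpow_mul_exp_mul_comp_mul hγ ha).symm) measurableSet_Ioi

lemma integral_rpow_mul_exp_mul_comp_mul (hγ : 0 < γ) :
    ∫ a in Ioi 0, a ^ x * exp (-z * a) * m (γ * a) =
      γ ^ (-x - 1) * ∫ t in Ioi 0, t ^ x * exp (-(z / γ) * t) * m t := by
  rw [setIntegral_congr_fun measurableSet_Ioi
    (fun a ha => rpow_mul_exp_mul_comp_mul hγ ha), integral_const_mul,
    integral_comp_mul_left_Ioi (fun t => t ^ x * exp (-(z / γ) * t) * m t) 0 hγ,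
    mul_zero, smul_eq_mul, rpow_sub_one hγ.ne']
  ring

/-- A rescaled damped moment is at most the corresponding rescaled moment. -/
lemma abs_integral_rpow_mul_exp_mul_comp_mul_le (hm_pos : ∀ t > 0, 0 < m t)
    (hint : IntegrableOn (fun t => t ^ x * m t) (Ioi 0)) (hz : 0 ≤ z) (hγ : 0 < γ) :
    |∫ a in Ioi 0, a ^ x * exp (-z * a) * m (γ * a)| ≤
      (∫ t in Ioi 0, t ^ x * m t) * γ ^ (-x - 1) := by
  have hpow : 0 < γ ^ (-x - 1) := rpow_pos_of_pos hγ _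
  have hzγ := div_nonneg hz hγ.le
  rw [integral_rpow_mul_exp_mul_comp_mul hγ, abs_mul, abs_of_pos hpow, mul_comm]
  gcongr
  rw [abs_of_nonneg]
  · refine setIntegral_mono_on (integrableOn_rpow_mul_exp_mul hint hzγ) hint measurableSet_Ioi
      fun t ht => ?_
    have ht0 : 0 < t := ht
    have := hm_pos t ht0
    have hexp : exp (-(z / γ) * t) ≤ 1 := exp_le_one_iff.mpr (by nlinarith)
    have htx := rpow_pos_of_pos ht0 x
    gcongr
    exact mul_le_of_le_one_right htx.le hexp
  · refine setIntegral_nonneg measurableSet_Ioi fun t ht => ?_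
    have ht0 : 0 < t := ht
    have := hm_pos t ht0
    positivity

/-- First-order expansion of a rescaled damped moment. -/
lemma abs_integral_rpow_mul_exp_mul_comp_mul_sub_le (hm_pos : ∀ t > 0, 0 < m t)
    (hint : IntegrableOn (fun t => t ^ x * m t) (Ioi 0))
    (hint' : IntegrableOn (fun t => t ^ (x + 1) * m t) (Ioi 0)) (hz : 0 ≤ z) (hγ : 0 < γ) :
    |(∫ a in Ioi 0, a ^ x * exp (-z * a) * m (γ * a)) -
        (∫ t in Ioi 0, t ^ x * m t) * γ ^ (-x - 1)| ≤
      z * (∫ t in Ioi 0, t ^ (x + 1) * m t) * γ ^ (-x - 2) := by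
  have hpow : 0 < γ ^ (-x - 1) := rpow_pos_of_pos hγ _
  have hzγ := div_nonneg hz hγ.le
  have hsplit : γ ^ (-x - 2) = γ ^ (-x - 1) / γ := by
    rw [← rpow_sub_one hγ.ne']; congr 1; ring
  have hdamp := integrableOn_rpow_mul_exp_mul hint hzγ
  have key : |(∫ t in Ioi 0, t ^ x * exp (-(z / γ) * t) * m t) - ∫ t in Ioi 0, t ^ x * m t| ≤
      z / γ * ∫ t in Ioi 0, t ^ (x + 1) * m t := by
    rw [← integral_sub hdamp hint, ← integral_const_mul, ← Real.norm_eq_abs]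
    refine norm_integral_le_of_norm_le (hint'.const_mul _)
      ((ae_restrict_iff' measurableSet_Ioi).mpr (Eventually.of_forall fun t ht => ?_))
    have ht0 : 0 < t := ht
    have hmt := hm_pos t ht0
    have htx := rpow_pos_of_pos ht0 x
    have hle : exp (-(z / γ) * t) ≤ 1 := exp_le_one_iff.mpr (by nlinarith)
    have hge := add_one_le_exp (-(z / γ) * t)
    have hfac : t ^ x * exp (-(z / γ) * t) * m t - t ^ x * m t =
        -((t ^ x * m t) * (1 - exp (-(z / γ) * t))) := by ring
    rw [hfac, norm_neg, norm_of_nonneg (mul_nonneg (by positivity) (by linarith)),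
      rpow_add_one ht0.ne']
    calc t ^ x * m t * (1 - exp (-(z / γ) * t)) ≤ t ^ x * m t * (z / γ * t) := by
          gcongr; linarith
      _ = z / γ * (t ^ x * t * m t) := by ring
  rw [integral_rpow_mul_exp_mul_comp_mul hγ, mul_comm (∫ t in Ioi 0, t ^ x * m t), ← mul_sub,
    abs_mul, abs_of_pos hpow, hsplit]
  calc _ ≤ γ ^ (-x - 1) * (z / γ * ∫ t in Ioi 0, t ^ (x + 1) * m t) := by gcongr
    _ = _ := by ring

end Rescaling

/-- For a mixture gamma density `f` and an MMSE-type function `m`,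
as `γ̄ → ∞`:
`∫_0^∞ a f(a) m(γ̄ a) da = (Σ_{l : β_l = β₁} α_l) M̂(β₁) γ̄^{−β₁−1} + O(γ̄^{−β₁−2})`. -/
theorem asymptotic_derivative_AMI
    (L : ℕ) (hL : 0 < L) (α β ζ : ℕ → ℝ)
    (hα : ∀ l < L, 0 < α l) (hβ : ∀ l < L, 0 < β l) (hζ : ∀ l < L, 0 < ζ l)
    (hmono : ∀ l, l + 1 < L → β l ≤ β (l + 1))
    (hgap : ∀ l, l + 1 < L → β (l + 1) = β l ∨ β l + 1 ≤ β (l + 1))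
    (hnorm : ∑ l ∈ Finset.range L, α l * Real.Gamma (β l) * (ζ l) ^ (-(β l)) = 1)
    (f : ℝ → ℝ)
    (hf : ∀ a > 0, f a = ∑ l ∈ Finset.range L, α l * a ^ (β l - 1) * Real.exp (-(ζ l) * a))
    (m : ℝ → ℝ)
    (hm_cont : ContinuousOn m (Set.Ioi 0))
    (hm_pos : ∀ t > 0, 0 < m t)
    (hm_lim : Tendsto m (nhdsWithin 0 (Set.Ioi 0)) (nhds 1))
    (hm_decay : ∃ C > 0, ∃ c > 0, ∀ t ≥ 1, m t ≤ C * t ^ (-(1 : ℝ) / 2) * Real.exp (-c * t))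
    (Mhat : ℝ → ℝ) (hMhat : ∀ x > 0, Mhat x = ∫ t in Set.Ioi 0, t ^ x * m t) :
    ∃ C' > 0, ∃ γ0 > 0, ∀ γ ≥ γ0,
      |(∫ a in Set.Ioi 0, a * f a * m (γ * a)) -
          (∑ l ∈ (Finset.range L).filter (fun l => β l = β 0), α l) * Mhat (β 0) *
            γ ^ (-(β 0) - 1)|
        ≤ C' * γ ^ (-(β 0) - 2) := by
  obtain ⟨K, c, hc, hm_le⟩ := exists_le_mul_exp_neg hm_cont hm_lim hm_decay
  have hint : ∀ x > (0 : ℝ), IntegrableOn (fun t => t ^ x * m t) (Ioi 0) := fun x hx =>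
    integrableOn_rpow_mul_of_le_exp hm_cont hm_pos hc hm_le hx
  have hdich : ∀ l < L, β l = β 0 ∨ β 0 + 1 ≤ β l := by
    intro l
    induction l with
    | zero => exact fun _ => Or.inl rfl
    | succ k ih =>
      intro hk
      rcases ih (by omega) with h | h <;> rcases hgap k hk with h' | h'
      · exact Or.inl (h'.trans h)
      · exact Or.inr (h ▸ h')
      · exact Or.inr (h'.symm ▸ h)
      · exact Or.inr (by linarith)
  have hMnn : ∀ x > 0, 0 ≤ Mhat x := fun x hx => by
    rw [hMhat x hx]
    exact setIntegral_nonneg measurableSet_Ioi fun t ht =>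
      mul_nonneg (rpow_nonneg (le_of_lt ht) _) (hm_pos t ht).le
  have hterm : ∀ l < L, ∃ B : ℝ, 0 ≤ B ∧ ∀ γ ≥ 1,
      |α l * (∫ a in Ioi 0, a ^ β l * exp (-(ζ l) * a) * m (γ * a)) -
        (if β l = β 0 then α l else 0) * Mhat (β 0) * γ ^ (-(β 0) - 1)| ≤
      B * γ ^ (-(β 0) - 2) := by
    intro l hl
    have hαl := hα l hl
    have hβl := hβ l hl
    have hζl := hζ l hl
    rcases hdich l hl with h | h
    · have hM := hMnn (β 0 + 1) (by linarith)
      refine ⟨α l * (ζ l * Mhat (β 0 + 1)), by positivity, fun γ hγ => ?_⟩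
      have hexpand := abs_integral_rpow_mul_exp_mul_comp_mul_sub_le hm_pos (hint _ hβl)
        (hint (β l + 1) (by linarith)) hζl.le (lt_of_lt_of_le one_pos hγ)
      rw [← hMhat _ hβl, ← hMhat (β l + 1) (by linarith), h] at hexpand
      rw [if_pos h, mul_assoc (α l), ← mul_sub, abs_mul, abs_of_pos hαl, mul_assoc (α l), h]
      gcongr
    · have hM := hMnn (β l) hβl
      refine ⟨α l * Mhat (β l), by positivity, fun γ hγ => ?_⟩
      have hbound := abs_integral_rpow_mul_exp_mul_comp_mul_le hm_pos (hint _ hβl) hζl.le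
        (lt_of_lt_of_le one_pos hγ)
      rw [← hMhat _ hβl] at hbound
      rw [if_neg (by linarith), zero_mul, zero_mul, sub_zero, abs_mul, abs_of_pos hαl, mul_assoc]
      gcongr
      exact hbound.trans
        (mul_le_mul_of_nonneg_left (rpow_le_rpow_of_exponent_le hγ (by linarith)) hM)
  choose! B hB0 hB using hterm
  have hBnn : 0 ≤ ∑ l ∈ Finset.range L, B l :=
    Finset.sum_nonneg fun l hl => hB0 l (Finset.mem_range.mp hl)
  refine ⟨(∑ l ∈ Finset.range L, B l) + 1, by linarith, 1, one_pos, fun γ hγ => ?_⟩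
  have hγ0 : 0 < γ := lt_of_lt_of_le one_pos hγ
  have hsum : ∫ a in Ioi 0, a * f a * m (γ * a) =
      ∑ l ∈ Finset.range L,
        α l * ∫ a in Ioi 0, a ^ β l * exp (-(ζ l) * a) * m (γ * a) := by
    simp_rw [← integral_const_mul]
    rw [← integral_finsetSum]
    · refine setIntegral_congr_fun measurableSet_Ioi fun a ha => ?_
      have ha0 : 0 < a := ha
      simp only [hf a ha0, Finset.mul_sum, Finset.sum_mul]
      refine Finset.sum_congr rfl fun l _ => ?_
      rw [rpow_sub_one ha0.ne']
      field_simp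
    · intro l hl
      have hl' := Finset.mem_range.mp hl
      exact (integrableOn_rpow_mul_exp_mul_comp_mul (hint _ (hβ l hl')) (hζ l hl').le
        hγ0).const_mul _
  rw [hsum, Finset.sum_filter, Finset.sum_mul, Finset.sum_mul, ← Finset.sum_sub_distrib]
  calc _ ≤ ∑ l ∈ Finset.range L, B l * γ ^ (-(β 0) - 2) :=
        (Finset.abs_sum_le_sum_abs _ _).trans
          (Finset.sum_le_sum fun l hl => hB l (Finset.mem_range.mp hl) γ hγ)
    _ = (∑ l ∈ Finset.range L, B l) * γ ^ (-(β 0) - 2) := by rw [Finset.sum_mul]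
    _ ≤ _ := by
      gcongr
      linarith
end
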